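/- Consider M jointly realizable linear regression tasks with data radius R > 0, and let w⋆ satisfy X_m w⋆ = y_m for all m. Let k ≥ 3, set the fixed regularization coefficient λ = R²(ln k − 1) (which is positive), let τ be a random with-replacement ordering of length k, and let w_0, w_1, …, w_k be the regularized continual linear regression iterates with λ_t = λ, started from an arbitrary w_0 ∈ ℝ^d. Then the expected average loss satisfies E_τ L(w_k) ≤ 5·‖w_0 − w⋆‖²·R²·(ln k)/k. -/

import Mathlib

open Matrix

/-- Matrix-vector multiplication viewed as a map between Euclidean spaces. -/
noncomputable def mulVecE {n d : ℕ} (X : Matrix (Fin n) (Fin d) ℝ)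
    (v : EuclideanSpace ℝ (Fin d)) : EuclideanSpace ℝ (Fin n) :=
  (WithLp.equiv 2 (Fin n → ℝ)).symm (X.mulVec (WithLp.equiv 2 (Fin d → ℝ) v))

section Helpers

lemma mulVecE_add' {n d : ℕ} (X : Matrix (Fin n) (Fin d) ℝ) (u v : EuclideanSpace ℝ (Fin d)) :
    mulVecE X (u + v) = mulVecE X u + mulVecE X v :=
  (Matrix.toEuclideanLin X).map_add u v

lemma mulVecE_sub' {n d : ℕ} (X : Matrix (Fin n) (Fin d) ℝ) (u v : EuclideanSpace ℝ (Fin d)) :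
    mulVecE X (u - v) = mulVecE X u - mulVecE X v :=
  (Matrix.toEuclideanLin X).map_sub u v

lemma mulVecE_mul' {n d e : ℕ} (A : Matrix (Fin n) (Fin d) ℝ) (B : Matrix (Fin d) (Fin e) ℝ)
    (v : EuclideanSpace ℝ (Fin e)) : mulVecE (A * B) v = mulVecE A (mulVecE B v) := by
  simp [mulVecE, Matrix.mulVec_mulVec]

lemma mulVecE_one' {d : ℕ} (v : EuclideanSpace ℝ (Fin d)) :
    mulVecE (1 : Matrix (Fin d) (Fin d) ℝ) v = v := by
  simp [mulVecE]

lemma mulVecE_gram {n d : ℕ} (X : Matrix (Fin n) (Fin d) ℝ) (lam : ℝ)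
    (v : EuclideanSpace ℝ (Fin d)) :
    mulVecE (Xᵀ * X + lam • (1 : Matrix (Fin d) (Fin d) ℝ)) v
      = mulVecE Xᵀ (mulVecE X v) + lam • v := by
  rw [← mulVecE_mul']
  ext i
  simp [mulVecE, Matrix.add_mulVec, Matrix.smul_mulVec]

lemma inner_mulVecE_transpose {n d : ℕ} (X : Matrix (Fin n) (Fin d) ℝ)
    (u : EuclideanSpace ℝ (Fin n)) (v : EuclideanSpace ℝ (Fin d)) :
    inner ℝ (mulVecE Xᵀ u) v = inner ℝ u (mulVecE X v) := by
  simp only [mulVecE, EuclideanSpace.inner_eq_star_dotProduct]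
  simp [Matrix.mulVec_transpose, Matrix.dotProduct_mulVec, dotProduct_comm, Matrix.dotProduct_mulVec]

lemma gram_isUnit {n d : ℕ} (X : Matrix (Fin n) (Fin d) ℝ) {lam : ℝ} (h : 0 < lam) :
    IsUnit (Xᵀ * X + lam • (1 : Matrix (Fin d) (Fin d) ℝ)).det := by
  have h1 : (Xᵀ * X).PosSemidef := by
    simpa using Matrix.posSemidef_conjTranspose_mul_self X
  have h2 : (lam • (1 : Matrix (Fin d) (Fin d) ℝ)).PosDef := Matrix.PosDef.one.smul h
  exact (Matrix.isUnit_iff_isUnit_det _).1 (Matrix.PosDef.posSemidef_add h1 h2).isUnit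

/-- Averaging (Markov) operator. -/
noncomputable def avgOp {E : Type*} {M : ℕ} (C : Fin M → E → E) (g : E → ℝ) : E → ℝ :=
  fun x => (∑ m, g (C m x)) / (M : ℝ)

lemma avgOp_mono {E : Type*} {M : ℕ} (C : Fin M → E → E) {g h : E → ℝ} (H : ∀ x, g x ≤ h x) (x : E) :
    avgOp C g x ≤ avgOp C h x := by
  unfold avgOp
  gcongr
  exact H _

lemma avgOp_iter_mono {E : Type*} {M : ℕ} (C : Fin M → E → E) (n : ℕ) :
    ∀ {g h : E → ℝ}, (∀ x, g x ≤ h x) → ∀ x, (avgOp C)^[n] g x ≤ (avgOp C)^[n] h x := by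
  induction n with
  | zero => intro g h H x; exact H x
  | succ n ih =>
    intro g h H x
    rw [Function.iterate_succ_apply', Function.iterate_succ_apply']
    exact avgOp_mono C (ih H) x

lemma avgOp_iter_smul {E : Type*} {M : ℕ} (C : Fin M → E → E) (n : ℕ) (c : ℝ) (g : E → ℝ) (x : E) :
    (avgOp C)^[n] (fun x => c * g x) x = c * (avgOp C)^[n] g x := by
  induction n generalizing x with
  | zero => rfl
  | succ n ih =>
    rw [Function.iterate_succ_apply', Function.iterate_succ_apply']
    simp only [avgOp, ih, ← Finset.mul_sum, mul_div_assoc]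

lemma avgOp_iter_sum {E : Type*} {M : ℕ} (C : Fin M → E → E) (n : ℕ) (s : Finset ℕ)
    (g : ℕ → E → ℝ) (x : E) :
    (avgOp C)^[n] (fun x => ∑ i ∈ s, g i x) x = ∑ i ∈ s, (avgOp C)^[n] (g i) x := by
  induction n generalizing x with
  | zero => rfl
  | succ n ih =>
    simp only [Function.iterate_succ_apply']
    simp only [avgOp, ih]
    rw [Finset.sum_comm, Finset.sum_div]

lemma sum_traj {E : Type*} {M : ℕ} (C : Fin M → E → E) (g : E → ℝ) (k : ℕ) :
    ∀ (x : E) (w : (Fin k → Fin M) → ℕ → E), (∀ τ, w τ 0 = x) →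
      (∀ τ (t : Fin k), w τ (t.1 + 1) = C (τ t) (w τ t.1)) →
      (∑ τ, g (w τ k)) / (M : ℝ) ^ k = (avgOp C)^[k] g x := by
  induction k with
  | zero => intro x w h0 _; simp [h0]
  | succ k ih =>
    intro x w h0 hs
    rw [Function.iterate_succ_apply']
    unfold avgOp
    rw [← (Fin.consEquiv (fun _ : Fin (k+1) => Fin M)).sum_comp, Fintype.sum_prod_type]
    rw [pow_succ, ← div_div, Finset.sum_div]
    congr 1
    refine Finset.sum_congr rfl fun m _ => ?_
    refine ih (C m x) (fun τ t => w (Fin.cons m τ) (t + 1)) ?_ ?_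
    · intro τ
      have := hs (Fin.cons m τ) 0
      simpa [h0] using this
    · intro τ t
      have := hs (Fin.cons m τ) t.succ
      simpa using this

lemma descent_iter {E : Type*} {M : ℕ} (hM : 0 < M) (C : Fin M → E → E) (h f : E → ℝ) (a b : ℝ)
    (hh : ∀ x, 0 ≤ h x) (hd : ∀ x, avgOp C h x ≤ h x - a * f x + b) (n : ℕ) :
    ∀ x, a * ∑ t ∈ Finset.range n, (avgOp C)^[t] f x ≤ h x + n * b := by
  induction n with
  | zero => intro x; simpa using hh x
  | succ n ih =>
    intro x
    have hM' : (0 : ℝ) < M := by exact_mod_cast hM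
    rw [Finset.sum_range_succ']
    have h1 : ∑ t ∈ Finset.range n, (avgOp C)^[t + 1] f x
        = avgOp C (fun x => ∑ t ∈ Finset.range n, (avgOp C)^[t] f x) x := by
      simp only [Function.iterate_succ_apply']
      exact (avgOp_iter_sum C 1 (Finset.range n) (fun t => (avgOp C)^[t] f) x).symm
    have h2 := avgOp_iter_smul C 1 a (fun x => ∑ t ∈ Finset.range n, (avgOp C)^[t] f x) x
    have h3 := avgOp_mono C ih x
    have h4 : avgOp C (fun x => h x + n * b) x = avgOp C h x + n * b := by
      simp only [avgOp, Finset.sum_add_distrib, Finset.sum_const, Finset.card_univ,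
        Fintype.card_fin, nsmul_eq_mul]
      field_simp
    simp only [Function.iterate_one] at h2
    have h5 := hd x
    rw [h1, mul_add]
    simp only [Function.iterate_zero, id]
    push_cast
    linarith

lemma last_le (c : ℕ → ℝ) (β : ℝ) (hβ : 0 ≤ β) (hc : ∀ i, 0 ≤ c i) (k : ℕ)
    (H : ∀ j, j ≤ k → (1 - β) * ∑ i ∈ Finset.range (j + 1), c i ≤ (j + 1) * c j) :
    ∀ j, j ≤ k → c 0 * (j + 1) ≤
      Real.exp (β * (harmonic j : ℚ)) * ∑ i ∈ Finset.range (j + 1), c i := by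
  intro j
  induction j with
  | zero => intro _; simp
  | succ j ih =>
    intro hj
    have h1 := ih (by omega)
    have h2 := H (j + 1) hj
    rw [Finset.sum_range_succ _ (j + 1)] at h2 ⊢
    set S := ∑ i ∈ Finset.range (j + 1), c i with hS
    have hS0 : 0 ≤ S := Finset.sum_nonneg fun i _ => hc i
    have hcj := hc (j + 1)
    rw [harmonic_succ]
    push_cast at h2 ⊢
    rw [mul_add β, Real.exp_add]
    set e := Real.exp (β * (harmonic j : ℚ)) with he
    have hepos : 0 < e := Real.exp_pos _
    have h3 := Real.add_one_le_exp (β * ((j : ℝ) + 1)⁻¹)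
    have hj1 : (0 : ℝ) < j + 1 := by positivity
    -- S * (j+2) ≤ (S + c) * (j+1+β)
    have h4 : S * (j + 2) ≤ (S + c (j + 1)) * (j + 1 + β) := by nlinarith
    have h5 : S * (j + 2) ≤ (j + 1) * ((β * ((j : ℝ) + 1)⁻¹ + 1) * (S + c (j + 1))) := by
      have : (j + 1 : ℝ) * ((β * ((j : ℝ) + 1)⁻¹ + 1) * (S + c (j + 1)))
        = (S + c (j + 1)) * (j + 1 + β) := by field_simp; ring
      rw [this]; exact h4
    have h6 : (j + 1 : ℝ) * (c 0 * (j + 2)) ≤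
        (j + 1) * (e * ((β * ((j : ℝ) + 1)⁻¹ + 1) * (S + c (j + 1)))) := by
      calc (j + 1 : ℝ) * (c 0 * (j + 2)) = (c 0 * (j + 1)) * (j + 2) := by ring
        _ ≤ (e * S) * (j + 2) := by gcongr
        _ = e * (S * (j + 2)) := by ring
        _ ≤ e * ((j + 1) * ((β * ((j : ℝ) + 1)⁻¹ + 1) * (S + c (j + 1)))) := by gcongr
        _ = _ := by ring
    have h7 := le_of_mul_le_mul_left h6 hj1
    calc c 0 * ((j : ℝ) + 1 + 1) = c 0 * (j + 2) := by ring
      _ ≤ _ := h7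
      _ ≤ e * (Real.exp (β * ((j : ℝ) + 1)⁻¹) * (S + c (j + 1))) := by gcongr
      _ = _ := by ring

lemma abstract_bound {E : Type*} [NormedAddCommGroup E] [InnerProductSpace ℝ E] {M : ℕ}
    (hM : 0 < M) (C : Fin M → E → E) (q : Fin M → E → ℝ) (β : ℝ) (hβ0 : 0 ≤ β) (hβ1 : β ≤ 1)
    (hq0 : ∀ m x, 0 ≤ q m x)
    (hq : ∀ m x, q m x = inner ℝ (x - C m x) x)
    (hqz : ∀ m x z, 0 ≤ q m x - 2 * inner ℝ (x - C m x) z + q m z)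
    (hb : ∀ m x, ‖x - C m x‖ ^ 2 ≤ β * q m x) (k : ℕ) (x : E) :
    (avgOp C)^[k] (fun x => (∑ m, q m x) / (M : ℝ)) x * (k + 1)
      ≤ Real.exp (β * (harmonic k : ℚ)) * ‖x‖ ^ 2 := by
  have hM' : (0 : ℝ) < M := by exact_mod_cast hM
  set f : E → ℝ := fun x => (∑ m, q m x) / (M : ℝ) with hf
  have hf0 : ∀ x, 0 ≤ f x := fun x => div_nonneg (Finset.sum_nonneg fun m _ => hq0 m x) hM'.le
  have hPf0 : ∀ n x, 0 ≤ (avgOp C)^[n] f x := by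
    intro n
    induction n with
    | zero => exact hf0
    | succ n ih =>
      intro x
      rw [Function.iterate_succ_apply']
      exact div_nonneg (Finset.sum_nonneg fun m _ => ih _) hM'.le
  have hexp : ∀ m x z, ‖C m x - z‖ ^ 2
      = ‖x - z‖ ^ 2 - 2 * q m x + 2 * inner ℝ (x - C m x) z + ‖x - C m x‖ ^ 2 := by
    intro m x z
    have : C m x - z = (x - z) - (x - C m x) := by abel
    rw [this, norm_sub_sq_real, real_inner_comm, inner_sub_right, hq]
    ring
  -- descent toward z
  have hdz : ∀ z x, avgOp C (fun x => ‖x - z‖ ^ 2) x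
      ≤ ‖x - z‖ ^ 2 - (1 - β) * f x + f z := by
    intro z x
    have : ∑ m, ‖C m x - z‖ ^ 2 ≤ ∑ m, (‖x - z‖ ^ 2 - (1 - β) * q m x + q m z) := by
      refine Finset.sum_le_sum fun m _ => ?_
      rw [hexp]
      linarith [hqz m x z, hb m x]
    simp only [avgOp, hf]
    rw [div_le_iff₀ hM']
    refine this.trans (le_of_eq ?_)
    rw [Finset.sum_add_distrib, Finset.sum_sub_distrib, ← Finset.mul_sum]
    simp only [Finset.sum_const, Finset.card_univ, Fintype.card_fin, nsmul_eq_mul]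
    field_simp
  have hd0 : ∀ x, avgOp C (fun x => ‖x‖ ^ 2) x ≤ ‖x‖ ^ 2 - 1 * f x + 0 := by
    intro x
    have : ∑ m, ‖C m x‖ ^ 2 ≤ ∑ m, (‖x‖ ^ 2 - q m x) := by
      refine Finset.sum_le_sum fun m _ => ?_
      have h1 := hexp m x 0
      simp only [sub_zero, inner_zero_right] at h1
      nlinarith [hb m x, hq0 m x]
    simp only [avgOp, hf]
    rw [div_le_iff₀ hM']
    refine this.trans (le_of_eq ?_)
    rw [Finset.sum_sub_distrib]
    simp only [Finset.sum_const, Finset.card_univ, Fintype.card_fin, nsmul_eq_mul]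
    field_simp
    ring
  have hsum : ∑ t ∈ Finset.range (k + 1), (avgOp C)^[t] f x ≤ ‖x‖ ^ 2 := by
    have := descent_iter hM C (fun x => ‖x‖ ^ 2) f 1 0 (fun x => by positivity) hd0 (k + 1) x
    simpa using this
  have hsuf : ∀ n z, (1 - β) * ∑ t ∈ Finset.range n, (avgOp C)^[t] f z ≤ n * f z := by
    intro n z
    have := descent_iter hM C (fun x => ‖x - z‖ ^ 2) f (1 - β) (f z)
      (fun x => by positivity) (hdz z) n z
    simpa using this
  have hsuf2 : ∀ s n, (1 - β) * ∑ t ∈ Finset.range n, (avgOp C)^[s + t] f x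
      ≤ n * (avgOp C)^[s] f x := by
    intro s n
    have h1 := avgOp_iter_mono C s (hsuf n) x
    rw [avgOp_iter_smul C s, avgOp_iter_smul C s,
      avgOp_iter_sum C s (Finset.range n) (fun t => (avgOp C)^[t] f)] at h1
    simpa only [Function.iterate_add_apply] using h1
  have hrefl : ∀ j, j ≤ k → ∑ i ∈ Finset.range (j + 1), (avgOp C)^[k - i] f x
      = ∑ t ∈ Finset.range (j + 1), (avgOp C)^[(k - j) + t] f x := by
    intro j hj
    rw [← Finset.sum_range_reflect]
    refine Finset.sum_congr rfl fun i hi => ?_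
    rw [Finset.mem_range] at hi
    have h : k - (j + 1 - 1 - i) = k - j + i := by omega
    rw [h]
  have key := last_le (fun i => (avgOp C)^[k - i] f x) β hβ0 (fun i => hPf0 _ _) k (by
    intro j hj
    rw [hrefl j hj]
    have := hsuf2 (k - j) (j + 1)
    push_cast at this
    exact this) k le_rfl
  rw [hrefl k le_rfl] at key
  simp only [Nat.sub_self, zero_add, Nat.sub_zero] at key
  refine key.trans ?_
  gcongr

end Helpers

/-- for `M` jointly realizable tasks with data radius `R` and `k ≥ 3`,
regularized continual linear regression with the fixed coefficient `λ = R²(ln k − 1)`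
under a random with-replacement ordering satisfies
`E_τ L(w_k) ≤ 5‖w₀−w⋆‖²R² (ln k)/k`. -/
theorem near_optimal_fixed_regularization {d M : ℕ} (hM : 0 < M)
    (nrows : Fin M → ℕ)
    (X : ∀ m : Fin M, Matrix (Fin (nrows m)) (Fin d) ℝ)
    (y : ∀ m : Fin M, EuclideanSpace ℝ (Fin (nrows m)))
    (R : ℝ) (hR : 0 < R)
    (hX : ∀ (m : Fin M) (v : EuclideanSpace ℝ (Fin d)), ‖mulVecE (X m) v‖ ≤ R * ‖v‖)
    (wstar : EuclideanSpace ℝ (Fin d)) (hreal : ∀ m, mulVecE (X m) wstar = y m)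
    (k : ℕ) (hk : 3 ≤ k)
    (lam : ℝ) (hlam : lam = R ^ 2 * (Real.log k - 1))
    (w0 : EuclideanSpace ℝ (Fin d))
    (w : (Fin k → Fin M) → ℕ → EuclideanSpace ℝ (Fin d))
    (hw0 : ∀ τ, w τ 0 = w0)
    (hwt : ∀ (τ : Fin k → Fin M) (t : Fin k),
      w τ (t.1 + 1) =
        mulVecE ((X (τ t))ᵀ * X (τ t) + lam • (1 : Matrix (Fin d) (Fin d) ℝ))⁻¹
          (mulVecE (X (τ t))ᵀ (y (τ t)) + lam • w τ t.1)) :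
    (∑ τ : Fin k → Fin M, (1 / (M : ℝ)) * ∑ m, (1 / 2) * ‖mulVecE (X m) (w τ k) - y m‖ ^ 2)
        / (M : ℝ) ^ k
      ≤ 5 * ‖w0 - wstar‖ ^ 2 * R ^ 2 * Real.log k / k := by
  have hM' : (0 : ℝ) < M := by exact_mod_cast hM
  have hk' : (3 : ℝ) ≤ k := by exact_mod_cast hk
  have hk0 : (0 : ℝ) < k := by linarith
  have hlog : 1 < Real.log k := by
    rw [Real.lt_log_iff_exp_lt hk0]
    linarith [Real.exp_one_lt_d9]
  have hlampos : 0 < lam := by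
    rw [hlam]; have := sub_pos.2 hlog; positivity
  have hRl : R ^ 2 + lam = R ^ 2 * Real.log k := by rw [hlam]; ring
  set C : Fin M → EuclideanSpace ℝ (Fin d) → EuclideanSpace ℝ (Fin d) := fun m x =>
    mulVecE ((X m)ᵀ * X m + lam • (1 : Matrix (Fin d) (Fin d) ℝ))⁻¹ (lam • x) with hC
  have hGl : ∀ m v, mulVecE ((X m)ᵀ * X m + lam • (1 : Matrix (Fin d) (Fin d) ℝ))
      (mulVecE ((X m)ᵀ * X m + lam • (1 : Matrix (Fin d) (Fin d) ℝ))⁻¹ v) = v := by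
    intro m v
    rw [← mulVecE_mul', Matrix.mul_nonsing_inv _ (gram_isUnit (X m) hlampos), mulVecE_one']
  have hGr : ∀ m v, mulVecE ((X m)ᵀ * X m + lam • (1 : Matrix (Fin d) (Fin d) ℝ))⁻¹
      (mulVecE ((X m)ᵀ * X m + lam • (1 : Matrix (Fin d) (Fin d) ℝ)) v) = v := by
    intro m v
    rw [← mulVecE_mul', Matrix.nonsing_inv_mul _ (gram_isUnit (X m) hlampos), mulVecE_one']
  have hCeq : ∀ m x, lam • (x - C m x) = mulVecE (X m)ᵀ (mulVecE (X m) (C m x)) := by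
    intro m x
    have := hGl m (lam • x)
    rw [mulVecE_gram] at this
    rw [smul_sub, sub_eq_iff_eq_add]
    exact this.symm
  -- inner products with the residual
  have hin : ∀ m x z, lam * inner ℝ (x - C m x) z
      = inner ℝ (mulVecE (X m) (C m x)) (mulVecE (X m) z) := by
    intro m x z
    rw [← inner_mulVecE_transpose, ← hCeq, real_inner_smul_left]
  have hin2 : ∀ m x z, inner ℝ (x - C m x) z
      = lam⁻¹ * inner ℝ (mulVecE (X m) (C m x)) (mulVecE (X m) (C m z))
        + inner ℝ (x - C m x) (z - C m z) := by
    intro m x z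
    rw [← hin m x (C m z), inner_sub_right]
    field_simp
    ring
  have hqform : ∀ m x, inner ℝ (x - C m x) x
      = lam⁻¹ * ‖mulVecE (X m) (C m x)‖ ^ 2 + ‖x - C m x‖ ^ 2 := by
    intro m x
    rw [hin2, real_inner_self_eq_norm_sq, real_inner_self_eq_norm_sq]
  have hq0 : ∀ m x, 0 ≤ inner ℝ (x - C m x) x := by
    intro m x
    rw [hqform]; positivity
  have hres : ∀ m x, lam * ‖x - C m x‖ ≤ R * ‖mulVecE (X m) (C m x)‖ := by
    intro m x
    rcases (norm_nonneg (x - C m x)).eq_or_lt with h0 | h0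
    · rw [← h0]; simp only [mul_zero]; positivity
    have h1 := hin m x (x - C m x)
    rw [real_inner_self_eq_norm_sq] at h1
    have h2 := real_inner_le_norm (mulVecE (X m) (C m x)) (mulVecE (X m) (x - C m x))
    have h3 := mul_le_mul_of_nonneg_left (hX m (x - C m x)) (norm_nonneg (mulVecE (X m) (C m x)))
    refine le_of_mul_le_mul_right ?_ h0
    nlinarith
  have hb : ∀ m x, ‖x - C m x‖ ^ 2 ≤ (Real.log k)⁻¹ * inner ℝ (x - C m x) x := by
    intro m x
    have h1 := hres m x
    have h2 : (lam * ‖x - C m x‖) ^ 2 ≤ (R * ‖mulVecE (X m) (C m x)‖) ^ 2 := by gcongr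
    rw [inv_mul_eq_div, le_div_iff₀ (by linarith), hqform]
    have h3 : (Real.log k - 1) * ‖x - C m x‖ ^ 2 ≤ lam⁻¹ * ‖mulVecE (X m) (C m x)‖ ^ 2 := by
      have h4 : Real.log k - 1 = lam / R ^ 2 := by rw [hlam]; field_simp
      rw [h4, inv_mul_eq_div, div_mul_eq_mul_div, div_le_div_iff₀ (by positivity) hlampos]
      nlinarith
    linarith
  have hqz : ∀ m x z, 0 ≤ inner ℝ (x - C m x) x - 2 * inner ℝ (x - C m x) z
      + inner ℝ (z - C m z) z := by
    intro m x z
    have h1 := norm_sub_sq_real (mulVecE (X m) (C m x)) (mulVecE (X m) (C m z))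
    have h2 := norm_sub_sq_real (x - C m x) (z - C m z)
    have h3 : 0 ≤ lam⁻¹ * ‖mulVecE (X m) (C m x) - mulVecE (X m) (C m z)‖ ^ 2 := by positivity
    have h4 : 0 ≤ ‖(x - C m x) - (z - C m z)‖ ^ 2 := by positivity
    rw [hqform, hqform, hin2]
    rw [h1] at h3
    rw [h2] at h4
    linarith
  have hloss : ∀ m x, ‖mulVecE (X m) x‖ ^ 2
      ≤ R ^ 2 * Real.log k * inner ℝ (x - C m x) x := by
    intro m x
    have h1 : mulVecE (X m) x = mulVecE (X m) (C m x) + mulVecE (X m) (x - C m x) := by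
      rw [← mulVecE_add']; congr 1; abel
    have h2 : ‖mulVecE (X m) x‖ ≤ ‖mulVecE (X m) (C m x)‖ + R * ‖x - C m x‖ := by
      rw [h1]
      exact (norm_add_le _ _).trans (by gcongr; exact hX m _)
    rw [← hRl, hqform]
    set a := ‖mulVecE (X m) (C m x)‖
    set b := ‖x - C m x‖
    have h3 : ‖mulVecE (X m) x‖ ^ 2 ≤ (a + R * b) ^ 2 := by gcongr
    have h4 : (R ^ 2 + lam) * (lam⁻¹ * a ^ 2 + b ^ 2) - (a + R * b) ^ 2
        = lam⁻¹ * (R * a - lam * b) ^ 2 := by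
      field_simp; ring
    have h5 : 0 ≤ lam⁻¹ * (R * a - lam * b) ^ 2 := by positivity
    linarith
  set f : EuclideanSpace ℝ (Fin d) → ℝ := fun x => (∑ m, inner ℝ (x - C m x) x) / (M : ℝ) with hf
  have hmain := abstract_bound hM C (fun m x => inner ℝ (x - C m x) x) (Real.log k)⁻¹
    (by positivity) (inv_le_one_of_one_le₀ hlog.le) hq0 (fun _ _ => rfl) hqz hb k (w0 - wstar)
  have htraj := sum_traj C f k (w0 - wstar) (fun τ t => w τ t - wstar)
    (fun τ => by simp only [hw0]) (by
      intro τ t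
      rw [hwt, ← hreal, sub_eq_iff_eq_add]
      have h1 : mulVecE (X (τ t))ᵀ (mulVecE (X (τ t)) wstar) + lam • w τ t.1
          = lam • (w τ t.1 - wstar)
            + mulVecE ((X (τ t))ᵀ * X (τ t) + lam • (1 : Matrix (Fin d) (Fin d) ℝ)) wstar := by
        rw [mulVecE_gram, smul_sub]; abel
      rw [h1, mulVecE_add', hGr])
  rw [← htraj] at hmain
  have hstep : (∑ τ : Fin k → Fin M,
      (1 / (M : ℝ)) * ∑ m, (1 / 2) * ‖mulVecE (X m) (w τ k) - y m‖ ^ 2) / (M : ℝ) ^ k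
      ≤ (R ^ 2 * Real.log k / 2) * ((∑ τ, f (w τ k - wstar)) / (M : ℝ) ^ k) := by
    rw [← mul_div_assoc, Finset.mul_sum]
    refine div_le_div_of_nonneg_right (Finset.sum_le_sum fun τ _ => ?_) (by positivity)
    rw [hf]
    simp only
    rw [← mul_div_assoc, one_div_mul_eq_div, Finset.mul_sum]
    refine div_le_div_of_nonneg_right (Finset.sum_le_sum fun m _ => ?_) hM'.le
    rw [← hreal, ← mulVecE_sub']
    linarith [hloss m (w τ k - wstar)]
  refine hstep.trans ?_
  set F := (∑ τ, f (w τ k - wstar)) / (M : ℝ) ^ k with hF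
  have hF0 : 0 ≤ F := by
    rw [hF]
    refine div_nonneg (Finset.sum_nonneg fun τ _ => ?_) (by positivity)
    exact div_nonneg (Finset.sum_nonneg fun m _ => hq0 m _) hM'.le
  have hexp : Real.exp ((Real.log k)⁻¹ * (harmonic k : ℚ)) ≤ 10 := by
    have h1 : (Real.log k)⁻¹ * ((harmonic k : ℚ) : ℝ) ≤ 2 := by
      rw [inv_mul_eq_div, div_le_iff₀ (by linarith)]
      linarith [harmonic_le_one_add_log k]
    have h2 : Real.exp 2 = Real.exp 1 * Real.exp 1 := by rw [← Real.exp_add]; norm_num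
    have h3 := Real.exp_le_exp.2 h1
    nlinarith [Real.exp_one_lt_d9, Real.exp_pos 1]
  have hFk : F * k ≤ 10 * ‖w0 - wstar‖ ^ 2 := by
    have : Real.exp ((Real.log k)⁻¹ * (harmonic k : ℚ)) * ‖w0 - wstar‖ ^ 2
      ≤ 10 * ‖w0 - wstar‖ ^ 2 := by gcongr
    linarith
  rw [le_div_iff₀ hk0]
  have hc : 0 ≤ R ^ 2 * Real.log k / 2 := by positivity
  calc R ^ 2 * Real.log k / 2 * F * k = R ^ 2 * Real.log k / 2 * (F * k) := by ring
    _ ≤ R ^ 2 * Real.log k / 2 * (10 * ‖w0 - wstar‖ ^ 2) := by gcongr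
    _ = _ := by ring
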